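/- arXiv:1808.04353 — 4 statements merged into one kernel-verified Lean document; each statement's English description precedes it below -/
import Mathlib

section
/- Let (x_p)_{p≥1} be a summable sequence of nonnegative real numbers and let k ≥ 1 be a natural number. Then lim_{u → 0+} (1/u^k) · ( ∏_{p=1}^{∞} 1/(1 + u·x_p) − Σ_{m=0}^{k−1} (−u)^m · h_m(x) ) = (−1)^k · h_k(x). -/
open Filter Topology

/-- The complete homogeneous symmetric function `h_m` of a sequence of real variables:
the sum over all nondecreasing `m`-tuples of indices (equivalently, over all finitely
supported exponent functions `a : ℕ →₀ ℕ` with total degree `m`) of the corresponding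
monomials. -/
noncomputable def completeHomog (x : ℕ → ℝ) (m : ℕ) : ℝ :=
  ∑' a : {a : ℕ →₀ ℕ // (a.sum fun _ e => e) = m},
    (a : ℕ →₀ ℕ).prod fun p e => x p ^ e

theorem one_sub_sum_le_prod_one_sub {ι : Type*} (s : Finset ι) {y : ι → ℝ}
    (h0 : ∀ p, 0 ≤ y p) (h1 : ∀ p, y p ≤ 1) :
    1 - ∑ p ∈ s, y p ≤ ∏ p ∈ s, (1 - y p) := by
  classical
  induction s using Finset.induction_on with
  | empty => simp
  | insert a s ha ih =>
    rw [Finset.sum_insert ha, Finset.prod_insert ha]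
    have hs : 0 ≤ ∑ p ∈ s, y p := Finset.sum_nonneg fun p _ => h0 p
    nlinarith [h0 a, h1 a, mul_nonneg (h0 a) hs,
      mul_le_mul_of_nonneg_left ih (sub_nonneg.2 (h1 a))]

/-- A finite product of geometric series, expanded into a sum over exponent tuples. -/
theorem hasSum_prod_pow_fin {n : ℕ} {y : Fin n → ℝ} (hy : ∀ i, |y i| < 1) :
    (Summable fun a : Fin n → ℕ => ‖∏ i, y i ^ a i‖) ∧
      HasSum (fun a : Fin n → ℕ => ∏ i, y i ^ a i) (∏ i, (1 - y i)⁻¹) := by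
  induction n with
  | zero => exact ⟨Summable.of_finite, by simp⟩
  | succ n ih =>
    obtain ⟨hs, hh⟩ := ih (y := fun i => y i.succ) fun i => hy i.succ
    have hg : HasSum (fun e : ℕ => y 0 ^ e) (1 - y 0)⁻¹ :=
      hasSum_geometric_of_abs_lt_one (hy 0)
    have hgs : Summable fun e : ℕ => ‖y 0 ^ e‖ := by
      simpa using summable_geometric_of_lt_one (abs_nonneg _) (hy 0)
    have hn := Summable.mul_norm hgs hs
    have hm := hg.mul hh hn.of_norm
    rw [← (Fin.consEquiv fun _ => ℕ).summable_iff, ← (Fin.consEquiv fun _ => ℕ).hasSum_iff]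
    constructor
    · simpa [Function.comp_def, Fin.consEquiv, Fin.prod_univ_succ] using hn
    · rw [Fin.prod_univ_succ]
      simpa [Function.comp_def, Fin.consEquiv, Fin.prod_univ_succ, -mul_inv_rev] using hm

open Classical in
theorem hasSum_ite_support_subset_range {y : ℕ → ℝ} (hy : ∀ p, |y p| < 1) (n : ℕ) :
    HasSum (fun a : ℕ →₀ ℕ =>
        if a.support ⊆ Finset.range n then a.prod fun p e => y p ^ e else 0)
      (∏ p ∈ Finset.range n, (1 - y p)⁻¹) := by
  have h := (hasSum_prod_pow_fin (n := n) (y := fun i => y i) fun i => hy i).2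
  rw [Finset.prod_range]
  rw [← Finsupp.equivFunOnFinite.hasSum_iff] at h
  rw [← (Finsupp.embDomain_injective Fin.valEmbedding).hasSum_iff]
  · convert h using 1
    funext a
    have hsub : (a.embDomain Fin.valEmbedding).support ⊆ Finset.range n := by
      intro p hp
      rw [Finsupp.support_embDomain, Finset.mem_map] at hp
      obtain ⟨i, -, rfl⟩ := hp
      simp
    simp only [Function.comp_apply, if_pos hsub]
    rw [Finsupp.prod_embDomain, Finsupp.prod_fintype _ _ (by simp)]
    simp
  · intro a ha
    rw [if_neg]
    contrapose! ha
    refine ⟨a.comapDomain Fin.valEmbedding Fin.valEmbedding.injective.injOn, ?_⟩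
    apply Finsupp.embDomain_comapDomain
    intro p hp
    exact ⟨⟨p, Finset.mem_range.1 (ha hp)⟩, rfl⟩

theorem summable_finsupp_prod_pow {y : ℕ → ℝ} (h0 : ∀ p, 0 ≤ y p) (hs : Summable y)
    (h1 : ∑' p, y p < 1) :
    Summable fun a : ℕ →₀ ℕ => a.prod fun p e => y p ^ e := by
  classical
  have hy1 : ∀ p, y p < 1 := fun p => (hs.le_tsum p fun j _ => h0 j).trans_lt h1
  have hnn : ∀ a : ℕ →₀ ℕ, 0 ≤ a.prod fun p e => y p ^ e := fun a =>
    Finset.prod_nonneg fun p _ => pow_nonneg (h0 p) _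
  refine summable_of_sum_le (c := (1 - ∑' p, y p)⁻¹) hnn fun A => ?_
  obtain ⟨n, hn⟩ := (A.biUnion Finsupp.support).exists_nat_subset_range
  have H := hasSum_ite_support_subset_range
    (fun p => by rw [abs_of_nonneg (h0 p)]; exact hy1 p) n
  calc ∑ a ∈ A, (a.prod fun p e => y p ^ e)
      = ∑ a ∈ A, if a.support ⊆ Finset.range n then a.prod fun p e => y p ^ e else 0 :=
        Finset.sum_congr rfl fun a ha =>
          (if_pos ((Finset.subset_biUnion_of_mem _ ha).trans hn)).symm
    _ ≤ ∏ p ∈ Finset.range n, (1 - y p)⁻¹ :=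
        sum_le_hasSum _ (fun a _ => by split_ifs; exacts [hnn a, le_rfl]) H
    _ ≤ (1 - ∑' p, y p)⁻¹ := by
        rw [Finset.prod_inv_distrib]
        refine inv_anti₀ (by linarith) ?_
        linarith [one_sub_sum_le_prod_one_sub (Finset.range n) h0 fun p => (hy1 p).le,
          hs.sum_le_tsum (Finset.range n) fun p _ => h0 p]

theorem tendsto_prod_range_inv_one_sub {y : ℕ → ℝ} (hs : Summable fun p => |y p|)
    (h1 : ∑' p, |y p| < 1) :
    Tendsto (fun n => ∏ p ∈ Finset.range n, (1 - y p)⁻¹) atTop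
      (𝓝 (∑' a : ℕ →₀ ℕ, a.prod fun p e => y p ^ e)) := by
  classical
  have hy1 : ∀ p, |y p| < 1 := fun p => (hs.le_tsum p fun j _ => abs_nonneg _).trans_lt h1
  have hS := summable_finsupp_prod_pow (fun p => abs_nonneg (y p)) hs h1
  have hab : ∀ a : ℕ →₀ ℕ, ‖a.prod fun p e => y p ^ e‖ = a.prod fun p e => |y p| ^ e := by
    intro a
    simp [Finsupp.prod]
  simp_rw [← fun n => (hasSum_ite_support_subset_range hy1 n).tsum_eq]
  refine tendsto_tsum_of_dominated_convergence hS (fun a => ?_) (Eventually.of_forall fun n a => ?_)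
  · obtain ⟨N, hN⟩ := a.support.exists_nat_subset_range
    refine tendsto_const_nhds.congr' ?_
    filter_upwards [eventually_ge_atTop N] with n hn
    rw [if_pos (hN.trans (Finset.range_mono hn))]
  · split_ifs
    · exact (hab a).le
    · rw [norm_zero, ← hab a]
      exact norm_nonneg _

theorem finsupp_prod_mul_pow (c : ℝ) (x : ℕ → ℝ) (a : ℕ →₀ ℕ) :
    (a.prod fun p e => (c * x p) ^ e) =
      c ^ (a.sum fun _ e => e) * a.prod fun p e => x p ^ e := by
  simp only [Finsupp.prod, Finsupp.sum, mul_pow, Finset.prod_mul_distrib, Finset.prod_pow_eq_pow_sum]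

theorem hasSum_pow_mul_completeHomog {c : ℝ} {x : ℕ → ℝ} (hx : ∀ p, 0 ≤ x p) (hs : Summable x)
    (h1 : |c| * ∑' p, x p < 1) :
    HasSum (fun m => c ^ m * completeHomog x m)
      (∑' a : ℕ →₀ ℕ, a.prod fun p e => (c * x p) ^ e) := by
  have hS : Summable fun a : ℕ →₀ ℕ => a.prod fun p e => (c * x p) ^ e := by
    refine Summable.of_norm ?_
    have := summable_finsupp_prod_pow (y := fun p => |c| * x p)
      (fun p => mul_nonneg (abs_nonneg c) (hx p)) (hs.mul_left _) (by rwa [tsum_mul_left])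
    refine this.congr fun a => ?_
    simp [Finsupp.prod, abs_of_nonneg (hx _)]
  have h := (Equiv.sigmaFiberEquiv fun a : ℕ →₀ ℕ => a.sum fun _ e => e).hasSum_iff.2 hS.hasSum
  have h' := h.summable.hasSum.sigma fun m => (h.summable.sigma_factor m).hasSum
  rw [h.tsum_eq] at h'
  convert h' using 2 with m
  rw [completeHomog, ← tsum_mul_left]
  refine tsum_congr fun a => ?_
  rw [Function.comp_apply, Equiv.sigmaFiberEquiv_apply, finsupp_prod_mul_pow, a.2]

theorem hasSum_tprod_one_div_one_add {u : ℝ} (hu : 0 ≤ u) {x : ℕ → ℝ} (hx : ∀ p, 0 ≤ x p)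
    (hs : Summable x) (h1 : u * ∑' p, x p < 1) :
    HasSum (fun m => (-u) ^ m * completeHomog x m) (∏' p : ℕ, 1 / (1 + u * x p)) := by
  have hux : ∀ p, 0 ≤ u * x p := fun p => mul_nonneg hu (hx p)
  have habs : ∀ p, |-u * x p| = u * x p := fun p => by
    rw [neg_mul, abs_neg, abs_of_nonneg (hux p)]
  have hM : Multipliable fun p : ℕ => 1 / (1 + u * x p) := by
    have hf : Summable fun p => 1 / (1 + u * x p) - 1 := by
      refine Summable.of_norm_bounded (hs.mul_left u) fun p => ?_
      have hp : 0 < 1 + u * x p := by linarith [hux p]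
      have : 1 / (1 + u * x p) - 1 = -(u * x p / (1 + u * x p)) := by field_simp; ring
      rw [this, norm_neg, Real.norm_of_nonneg (div_nonneg (hux p) hp.le)]
      exact div_le_self (hux p) (by linarith [hux p])
    simpa using Real.multipliable_one_add_of_summable hf
  have hlim := tendsto_prod_range_inv_one_sub (y := fun p => -u * x p)
    (by simpa only [habs] using hs.mul_left u) (by simpa only [habs, tsum_mul_left] using h1)
  have heq := tendsto_nhds_unique hM.hasProd.tendsto_prod_nat (by simpa using hlim)
  rw [heq]
  simpa using hasSum_pow_mul_completeHomog (c := -u) hx hs (by rwa [abs_neg, abs_of_nonneg hu])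

theorem infinite_product_kth_derivative_at_zero
    (x : ℕ → ℝ) (hx : ∀ p, 0 ≤ x p) (hsum : Summable x) (k : ℕ) (hk : 1 ≤ k) :
    Tendsto (fun u : ℝ =>
        (1 / u ^ k) * ((∏' p : ℕ, 1 / (1 + u * x p)) -
          ∑ m ∈ Finset.range k, (-u) ^ m * completeHomog x m))
      (𝓝[>] 0) (𝓝 ((-1) ^ k * completeHomog x k)) := by
  have hT : 0 ≤ ∑' p, x p := tsum_nonneg hx
  obtain ⟨r, hr, hrT⟩ : ∃ r : ℝ, 0 < r ∧ r * ∑' p, x p < 1 := by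
    refine ⟨1 / (1 + ∑' p, x p), by positivity, ?_⟩
    rw [div_mul_eq_mul_div, div_lt_one (by positivity)]
    linarith
  set c : ℕ → ℝ := fun m => (-1) ^ (m + k) * completeHomog x (m + k) with hc
  have hterm : ∀ (u : ℝ) m, (-u) ^ (m + k) * completeHomog x (m + k) = u ^ k * (c m * u ^ m) := by
    intro u m
    rw [hc, neg_pow u, pow_add u]
    ring
  have hbound : Summable fun m => ‖c m * r ^ m‖ := by
    have h := (summable_nat_add_iff k).2 (hasSum_tprod_one_div_one_add hr.le hx hsum hrT).summable
    simp only [hterm] at h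
    exact ((summable_mul_left_iff (pow_ne_zero k hr.ne')).1 h).norm
  have hlim : Tendsto (fun u : ℝ => ∑' m, c m * u ^ m) (𝓝[>] 0) (𝓝 (∑' m, c m * 0 ^ m)) := by
    refine tendsto_tsum_of_dominated_convergence hbound (fun m => ?_) ?_
    · have : Continuous fun u : ℝ => c m * u ^ m := by fun_prop
      exact (this.tendsto 0).mono_left nhdsWithin_le_nhds
    · filter_upwards [Ioo_mem_nhdsGT hr] with u hu m
      simp only [norm_mul, norm_pow, Real.norm_of_nonneg hu.1.le, Real.norm_of_nonneg hr.le]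
      gcongr
      exacts [hu.1.le, hu.2.le]
  have h0 : ∑' m, c m * 0 ^ m = (-1) ^ k * completeHomog x k := by
    rw [tsum_eq_single 0 fun m hm => by simp [hm]]
    simp [hc]
  rw [h0] at hlim
  refine hlim.congr' ?_
  filter_upwards [Ioo_mem_nhdsGT hr] with u hu
  have hH := hasSum_tprod_one_div_one_add hu.1.le hx hsum
    ((mul_le_mul_of_nonneg_right hu.2.le hT).trans_lt hrT)
  rw [← hH.tsum_eq, ← hH.summable.sum_add_tsum_nat_add k, add_sub_cancel_left]
  simp only [hterm]
  rw [tsum_mul_left, ← mul_assoc, one_div_mul_cancel (pow_ne_zero k hu.1.ne'), one_mul]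
end

section
/- Let (x_p)_{p≥1} be a summable sequence of nonnegative real numbers, and let n ≥ 0 and k ≥ 1 be natural numbers. Then h_n^{(k)}(x) · Σ_{p=1}^{∞} x_p^{k+1} ≤ h_{n+k+1}^{(2k+1)}(x). -/
/-- The truncated complete homogeneous symmetric function `h_n^{(k)}` of a sequence of real
variables: the sum over all finitely supported exponent functions `a : ℕ →₀ ℕ` with total
degree `n` in which every individual exponent is at most `k`, of the corresponding
monomials. -/
noncomputable def truncHomog (x : ℕ → ℝ) (k n : ℕ) : ℝ :=
  ∑' a : {a : ℕ →₀ ℕ // (a.sum fun _ e => e) = n ∧ ∀ p, a p ≤ k},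
    (a : ℕ →₀ ℕ).prod fun p e => x p ^ e

/-- The monomial with exponent function `a` evaluated at a sequence of real variables. -/
noncomputable def monomialEval (x : ℕ → ℝ) (a : ℕ →₀ ℕ) : ℝ :=
  a.prod fun p e => x p ^ e

theorem monomialEval_nonneg {x : ℕ → ℝ} (hx : ∀ p, 0 ≤ x p) (a : ℕ →₀ ℕ) :
    0 ≤ monomialEval x a :=
  Finset.prod_nonneg fun p _ => pow_nonneg (hx p) _

theorem monomialEval_add (x : ℕ → ℝ) (a b : ℕ →₀ ℕ) :
    monomialEval x (a + b) = monomialEval x a * monomialEval x b :=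
  Finsupp.prod_add_index' (fun _ => pow_zero _) fun _ _ _ => pow_add _ _ _

theorem monomialEval_single (x : ℕ → ℝ) (p e : ℕ) :
    monomialEval x (Finsupp.single p e) = x p ^ e :=
  Finsupp.prod_single_index (pow_zero _)

/-- The monomials of a fixed total degree in a summable nonnegative sequence are summable. -/
theorem summable_monomialEval {x : ℕ → ℝ} (hx : ∀ p, 0 ≤ x p) (hsum : Summable x) (n : ℕ) :
    Summable fun a : {a : ℕ →₀ ℕ // a.degree = n} => monomialEval x a := by
  induction n with
  | zero =>
    have : Subsingleton {a : ℕ →₀ ℕ // a.degree = 0} :=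
      ⟨fun a b => Subtype.ext <| by
        rw [(Finsupp.degree_eq_zero_iff _).1 a.2, (Finsupp.degree_eq_zero_iff _).1 b.2]⟩
    exact Summable.of_finite
  | succ n ih =>
    have key : ∀ a : {a : ℕ →₀ ℕ // a.degree = n + 1},
        ∃ q : ℕ × {a : ℕ →₀ ℕ // a.degree = n}, Finsupp.single q.1 1 + q.2.1 = a.1 := by
      rintro ⟨a, ha⟩
      obtain ⟨p, hp⟩ : ∃ p, a p ≠ 0 := by
        by_contra! h
        have : a = 0 := Finsupp.ext h
        simp [this] at ha
      have hle : Finsupp.single p 1 ≤ a := by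
        rw [Finsupp.single_le_iff]
        exact Nat.one_le_iff_ne_zero.2 hp
      have hadd : Finsupp.single p 1 + (a - Finsupp.single p 1) = a := add_tsub_cancel_of_le hle
      refine ⟨⟨p, a - Finsupp.single p 1, ?_⟩, hadd⟩
      have hdeg := congrArg Finsupp.degree hadd
      rw [map_add, Finsupp.degree_single, ha] at hdeg
      omega
    choose s hs using key
    have hinj : Function.Injective s := fun a b h => Subtype.ext <| by rw [← hs a, ← hs b, h]
    refine ((hsum.mul_of_nonneg ih hx fun a => monomialEval_nonneg hx a).comp_injective
      hinj).congr fun a => ?_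
    rw [← hs a, monomialEval_add, monomialEval_single, pow_one]
    rfl

theorem degree_eq_sum_id (a : ℕ →₀ ℕ) : a.degree = a.sum fun _ e => e :=
  rfl

theorem summable_truncHomog {x : ℕ → ℝ} (hx : ∀ p, 0 ≤ x p) (hsum : Summable x) (k n : ℕ) :
    Summable fun a : {a : ℕ →₀ ℕ // (a.sum fun _ e => e) = n ∧ ∀ p, a p ≤ k} =>
      monomialEval x a := by
  let i : {a : ℕ →₀ ℕ // (a.sum fun _ e => e) = n ∧ ∀ p, a p ≤ k} →
      {a : ℕ →₀ ℕ // a.degree = n} := fun a => 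
    ⟨a.1, (degree_eq_sum_id a.1).trans a.2.1⟩
  have hi : Function.Injective i := fun a b h => by
    have hab : (i a).1 = (i b).1 := by rw [h]
    exact Subtype.ext hab
  exact ((summable_monomialEval hx hsum n).comp_injective hi).congr fun _ => rfl

theorem summable_pow_of_summable {x : ℕ → ℝ} (hx : ∀ p, 0 ≤ x p) (hsum : Summable x) {m : ℕ}
    (hm : m ≠ 0) : Summable fun p => x p ^ m := by
  let i : ℕ → {a : ℕ →₀ ℕ // a.degree = m} := fun p =>
    ⟨Finsupp.single p m, Finsupp.degree_single p m⟩
  have hi : Function.Injective i := fun p q h => by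
    have hpq : (i p).1 = (i q).1 := by rw [h]
    exact Finsupp.single_left_injective hm hpq
  exact ((summable_monomialEval hx hsum m).comp_injective hi).congr
    fun p => monomialEval_single x p m

/-- If all exponents of `b` are at most `k`, then `b` and `q` are determined by the result of adding
`k + 1` to the exponent of `b` at `q`. -/
theorem add_single_succ_inj {a b : ℕ →₀ ℕ} {k p q : ℕ} (hb : ∀ i, b i ≤ k)
    (h : a + Finsupp.single p (k + 1) = b + Finsupp.single q (k + 1)) : a = b ∧ p = q := by
  have hpq : p = q := by
    by_contra hne
    have hp := DFunLike.congr_fun h p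
    simp only [Finsupp.add_apply, Finsupp.single_eq_same, Finsupp.single_eq_of_ne hne] at hp
    have := hb p
    omega
  subst hpq
  exact ⟨add_right_cancel h, rfl⟩

theorem truncHomog_mul_power_sum_le
    (x : ℕ → ℝ) (hx : ∀ p, 0 ≤ x p) (hsum : Summable x) (n k : ℕ) (hk : 1 ≤ k) :
    truncHomog x k n * ∑' p : ℕ, x p ^ (k + 1) ≤ truncHomog x (2 * k + 1) (n + k + 1) := by
  have h1 := summable_truncHomog hx hsum k n
  have h2 := summable_pow_of_summable hx hsum k.succ_ne_zero
  have h12 := h1.mul_of_nonneg h2 (fun a => monomialEval_nonneg hx a) fun p => pow_nonneg (hx p) _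
  let s : {a : ℕ →₀ ℕ // (a.sum fun _ e => e) = n ∧ ∀ p, a p ≤ k} × ℕ →
      {a : ℕ →₀ ℕ // (a.sum fun _ e => e) = n + k + 1 ∧ ∀ p, a p ≤ 2 * k + 1} := fun q =>
    ⟨q.1.1 + Finsupp.single q.2 (k + 1), by
      rw [← degree_eq_sum_id, map_add, Finsupp.degree_single, degree_eq_sum_id, q.1.2.1,
        add_assoc], fun p => by
      have hq := q.1.2.2 p
      rw [Finsupp.add_apply, Finsupp.single_apply]
      split_ifs <;> omega⟩
  have hs : Function.Injective s := fun q r h => by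
    obtain ⟨ha, hp⟩ := add_single_succ_inj r.1.2.2 (congrArg Subtype.val h)
    exact Prod.ext (Subtype.ext ha) hp
  refine (h1.tsum_mul_tsum h2 h12).trans_le ?_
  refine h12.tsum_le_tsum_of_inj s hs (fun a _ => monomialEval_nonneg hx a) (fun q => ?_)
    (summable_truncHomog hx hsum (2 * k + 1) (n + k + 1))
  exact ((monomialEval_add x _ _).trans (by rw [monomialEval_single])).ge
end

section
/- Let k be an even natural number, let (x_p)_{p≥1} be a summable sequence of nonnegative real numbers, and let u ≥ 0 satisfy u · Σ_p x_p < 1. Then | ∏_{p=1}^{∞} 1/(1 + u·x_p) − Σ_{n=0}^{k} (−u)^n · h_n(x) | ≤ Σ_{n=k+1}^{∞} h_n^{(k)}(x) · u^n + u^{k+1} · ( Σ_{n=0}^{∞} h_n^{(k)}(x) · u^n ) · Σ_{p=1}^{∞} x_p^{k+1}, where all series converge. -/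
/-- The monomial `∏ p, z p ^ a p` attached to an exponent function `a`. -/
noncomputable def expMonomial (z : ℕ → ℝ) (a : ℕ →₀ ℕ) : ℝ :=
  a.prod fun p e => z p ^ e

theorem expMonomial_const_mul (c : ℝ) (x : ℕ → ℝ) (a : ℕ →₀ ℕ) :
    expMonomial (fun p => c * x p) a = c ^ (a.sum fun _ e => e) * expMonomial x a := by
  simp only [expMonomial, Finsupp.prod, Finsupp.sum, mul_pow, Finset.prod_mul_distrib,
    Finset.prod_pow_eq_pow_sum]

theorem abs_expMonomial (z : ℕ → ℝ) (a : ℕ →₀ ℕ) :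
    |expMonomial z a| = expMonomial (fun p => |z p|) a := by
  simp only [expMonomial, Finsupp.prod, Finset.abs_prod, abs_pow]

open Classical in
/-- The exponent functions supported in `Finset.range N` with all exponents at most `k`. -/
noncomputable def exponentBox (k N : ℕ) : Finset {a : ℕ →₀ ℕ // ∀ p, a p ≤ k} :=
  ((Finset.range N).finsupp fun _ => Finset.range (k + 1)).subtype _

theorem mem_exponentBox {k N : ℕ} {a : {a : ℕ →₀ ℕ // ∀ p, a p ≤ k}} :
    a ∈ exponentBox k N ↔ (a : ℕ →₀ ℕ).support ⊆ Finset.range N := by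
  simp only [exponentBox, Finset.mem_subtype, Finset.mem_finsupp_iff, Finset.mem_range,
    and_iff_left_iff_imp]
  exact fun _ i _ => Nat.lt_succ_of_le (a.2 i)

theorem tendsto_exponentBox (k : ℕ) :
    Filter.Tendsto (exponentBox k) Filter.atTop Filter.atTop := by
  refine Filter.tendsto_atTop_finset_of_monotone ?_ ?_
  · intro M N h a
    simp only [mem_exponentBox]
    exact fun ha => ha.trans (Finset.range_mono h)
  · intro a
    obtain ⟨N, hN⟩ := (a : ℕ →₀ ℕ).support.exists_nat_subset_range
    exact ⟨N, mem_exponentBox.2 hN⟩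

open Classical in
theorem sum_exponentBox (z : ℕ → ℝ) (k N : ℕ) :
    ∑ a ∈ exponentBox k N, expMonomial z a =
      ∏ p ∈ Finset.range N, ∑ j ∈ Finset.range (k + 1), z p ^ j := by
  rw [exponentBox, Finset.sum_subtype_of_mem (expMonomial z), Finset.prod_sum, Finset.finsupp,
    Finset.sum_map]
  · refine Finset.sum_congr (by congr!) fun f _ => ?_
    simp only [Function.Embedding.coeFn_mk, expMonomial]
    rw [Finsupp.prod_of_support_subset _ (Finsupp.support_indicator_subset _ _) _ (by simp),
      ← Finset.prod_attach]
    refine Finset.prod_congr rfl fun p _ => ?_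
    rw [Finsupp.indicator_of_mem p.2]
  · intro a ha p
    rw [Finset.mem_finsupp_iff] at ha
    by_cases hp : p ∈ Finset.range N
    · exact Nat.le_of_lt_succ (Finset.mem_range.1 (ha.2 p hp))
    · rw [Finsupp.notMem_support_iff.1 fun h => hp (ha.1 h)]
      exact Nat.zero_le k

theorem multipliable_geom_sum {z : ℕ → ℝ} (hz : Summable fun p => |z p|) (k : ℕ) :
    Multipliable fun p => ∑ j ∈ Finset.range (k + 1), z p ^ j := by
  have h : Summable fun p => ∑ j ∈ Finset.range k, z p ^ (j + 1) := by
    refine summable_sum fun j _ => ?_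
    refine Summable.of_norm_bounded_eventually_nat hz ?_
    filter_upwards [hz.tendsto_atTop_zero.eventually (ge_mem_nhds zero_lt_one)] with p hp
    rw [Real.norm_eq_abs, abs_pow, pow_succ]
    exact mul_le_of_le_one_left (abs_nonneg _) (pow_le_one₀ (abs_nonneg _) hp)
  refine (Real.multipliable_one_add_of_summable h).congr fun p => ?_
  rw [Finset.sum_range_succ', pow_zero, add_comm]

theorem hasSum_expMonomial {z : ℕ → ℝ} (hz : Summable fun p => |z p|) (k : ℕ) :
    HasSum (fun a : {a : ℕ →₀ ℕ // ∀ p, a p ≤ k} => expMonomial z a)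
      (∏' p, ∑ j ∈ Finset.range (k + 1), z p ^ j) := by
  have habs : Summable fun a : {a : ℕ →₀ ℕ // ∀ p, a p ≤ k} =>
      expMonomial (fun p => |z p|) a := by
    have hm := (multipliable_geom_sum (z := fun p => |z p|) (by simpa using hz) k).hasProd
      |>.tendsto_prod_nat
    obtain ⟨C, hC⟩ := hm.bddAbove_range
    refine summable_of_sum_le (c := C) (fun a => ?_) fun s => ?_
    · rw [← abs_expMonomial]
      exact abs_nonneg _
    · obtain ⟨N, hN⟩ := ((tendsto_exponentBox k).eventually_ge_atTop s).exists
      refine (Finset.sum_le_sum_of_subset_of_nonneg hN fun a _ _ => ?_).trans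
        ((sum_exponentBox _ k N).trans_le (hC ⟨N, rfl⟩))
      rw [← abs_expMonomial]
      exact abs_nonneg _
  have hs : Summable fun a : {a : ℕ →₀ ℕ // ∀ p, a p ≤ k} => expMonomial z a := by
    refine Summable.of_abs ?_
    simpa only [abs_expMonomial] using habs
  have h₁ := hs.hasSum.comp (tendsto_exponentBox k)
  have h₂ := (multipliable_geom_sum hz k).hasProd.tendsto_prod_nat
  simp only [Function.comp_def, sum_exponentBox] at h₁
  rw [← tendsto_nhds_unique h₁ h₂]
  exact hs.hasSum

/-- Exponent functions bounded by `k`, grouped by total degree. -/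
def sigmaDegreeEquiv (k : ℕ) :
    (Σ n : ℕ, {a : ℕ →₀ ℕ // (a.sum fun _ e => e) = n ∧ ∀ p, a p ≤ k}) ≃
      {a : ℕ →₀ ℕ // ∀ p, a p ≤ k} where
  toFun s := ⟨s.2, s.2.2.2⟩
  invFun a := ⟨_, a, rfl, a.2⟩
  left_inv := by
    rintro ⟨_, a, rfl, ha⟩
    rfl
  right_inv _ := rfl

/-- The generating function of the truncated complete homogeneous symmetric functions. -/
theorem hasSum_truncHomog {x : ℕ → ℝ} (hx : Summable fun p => |x p|) (k : ℕ) (c : ℝ) :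
    HasSum (fun n => truncHomog x k n * c ^ n)
      (∏' p, ∑ j ∈ Finset.range (k + 1), (c * x p) ^ j) := by
  have hz : Summable fun p => |c * x p| := by
    simpa only [abs_mul] using hx.mul_left |c|
  have h := (sigmaDegreeEquiv k).hasSum_iff.2 (hasSum_expMonomial hz k)
  convert h.sigma fun n => (h.summable.sigma_factor n).hasSum using 2 with n
  rw [truncHomog, ← tsum_mul_right]
  refine tsum_congr fun a => ?_
  simp only [Function.comp_apply, sigmaDegreeEquiv, Equiv.coe_fn_mk]
  rw [expMonomial_const_mul, a.2.1, mul_comm, expMonomial]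

theorem truncHomog_eq_completeHomog (x : ℕ → ℝ) {k n : ℕ} (h : n ≤ k) :
    truncHomog x k n = completeHomog x n := by
  refine (Equiv.subtypeEquivRight fun a => and_iff_left_of_imp ?_).tsum_eq
    fun a : {a : ℕ →₀ ℕ // (a.sum fun _ e => e) = n} => (a : ℕ →₀ ℕ).prod fun p e => x p ^ e
  rintro rfl p
  refine le_trans ?_ h
  by_cases hp : p ∈ a.support
  · exact Finset.single_le_sum (f := a) (fun _ _ => Nat.zero_le _) hp
  · rw [Finsupp.notMem_support_iff.1 hp]
    exact Nat.zero_le _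

theorem geom_sum_neg_of_even {k : ℕ} (hk : Even k) {y : ℝ} (hy : 0 ≤ y) :
    ∑ j ∈ Finset.range (k + 1), (-y) ^ j = (1 + y ^ (k + 1)) / (1 + y) := by
  rw [eq_div_iff (by positivity)]
  have h := geom_sum_mul_neg (-y) (k + 1)
  rwa [hk.add_one.neg_pow, sub_neg_eq_add, sub_neg_eq_add] at h

theorem prod_inv_one_add_bounds {y z : ℕ → ℝ} (hy : ∀ p, 0 ≤ y p) (hz : ∀ p, 0 ≤ z p) (N : ℕ) :
    (∏ p ∈ Finset.range N, (1 + z p) / (1 + y p)) * (1 - ∑ p ∈ Finset.range N, z p) ≤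
        ∏ p ∈ Finset.range N, 1 / (1 + y p) ∧
      ∏ p ∈ Finset.range N, 1 / (1 + y p) ≤ ∏ p ∈ Finset.range N, (1 + z p) / (1 + y p) := by
  constructor
  · induction N with
    | zero => simp
    | succ N ih =>
      have hQ : 0 ≤ ∏ p ∈ Finset.range N, (1 + z p) / (1 + y p) :=
        Finset.prod_nonneg fun p _ => by have := hy p; have := hz p; positivity
      have hS : 0 ≤ ∑ p ∈ Finset.range N, z p := Finset.sum_nonneg fun p _ => hz p
      rw [Finset.prod_range_succ, Finset.prod_range_succ, Finset.sum_range_succ]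
      have hyN := hy N
      have hzN := hz N
      generalize (∏ p ∈ Finset.range N, (1 + z p) / (1 + y p)) = Q at *
      generalize (∑ p ∈ Finset.range N, z p) = S at *
      rw [mul_one_div, mul_div_assoc', div_mul_eq_mul_div]
      gcongr
      refine le_trans ?_ ih
      have : 0 ≤ Q * (z N * (S + z N)) := by positivity
      linarith
  · refine Finset.prod_le_prod (fun p _ => ?_) fun p _ => ?_
    · have := hy p
      positivity
    · have := hy p
      have := hz p
      gcongr
      linarith

theorem abs_tprod_sub_tprod_le {y z : ℕ → ℝ} (hy : ∀ p, 0 ≤ y p) (hz : ∀ p, 0 ≤ z p)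
    (hys : Summable y) (hzs : Summable z)
    (hm : Multipliable fun p => (1 + z p) / (1 + y p)) :
    |(∏' p, 1 / (1 + y p)) - ∏' p, (1 + z p) / (1 + y p)| ≤
      (∏' p, (1 + z p) / (1 + y p)) * ∑' p, z p := by
  have hA : Multipliable fun p => 1 / (1 + y p) := by
    have hs : Summable fun p => -(y p / (1 + y p)) := by
      refine (Summable.of_nonneg_of_le (fun p => ?_) (fun p => ?_) hys).neg
      · have := hy p
        positivity
      · exact div_le_self (hy p) (by linarith [hy p])
    refine (Real.multipliable_one_add_of_summable hs).congr fun p => ?_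
    have := hy p
    field_simp
    ring
  have tA := hA.hasProd.tendsto_prod_nat
  have tQ := hm.hasProd.tendsto_prod_nat
  have tS := hzs.hasSum.tendsto_sum_nat
  have h₁ := le_of_tendsto_of_tendsto' (tQ.mul (tS.const_sub 1)) tA
    fun N => (prod_inv_one_add_bounds hy hz N).1
  have h₂ := le_of_tendsto_of_tendsto' tA tQ fun N => (prod_inv_one_add_bounds hy hz N).2
  rw [abs_of_nonpos (by linarith)]
  linarith

theorem infinite_product_truncation_error_bound
    (k : ℕ) (hk : Even k) (x : ℕ → ℝ) (hx : ∀ p, 0 ≤ x p) (hsum : Summable x)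
    (u : ℝ) (hu : 0 ≤ u) (hu1 : u * ∑' p : ℕ, x p < 1) :
    Summable (fun n : ℕ => truncHomog x k n * u ^ n) ∧
    Summable (fun p : ℕ => x p ^ (k + 1)) ∧
    |(∏' p : ℕ, 1 / (1 + u * x p)) -
        ∑ n ∈ Finset.range (k + 1), (-u) ^ n * completeHomog x n| ≤
      (∑' n : ℕ, truncHomog x k (n + (k + 1)) * u ^ (n + (k + 1))) +
        u ^ (k + 1) * (∑' n : ℕ, truncHomog x k n * u ^ n) *
          ∑' p : ℕ, x p ^ (k + 1) := by
  have hxa : Summable fun p => |x p| := hsum.abs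
  have hH : Summable fun n => truncHomog x k n * u ^ n := (hasSum_truncHomog hxa k u).summable
  have hpow : Summable fun p => x p ^ (k + 1) := by
    refine Summable.of_norm_bounded_eventually_nat hsum ?_
    filter_upwards [hsum.tendsto_atTop_zero.eventually (ge_mem_nhds zero_lt_one)] with p hp
    rw [Real.norm_of_nonneg (pow_nonneg (hx p) _), pow_succ]
    exact mul_le_of_le_one_left (hx p) (pow_le_one₀ (hx p) hp)
  refine ⟨hH, hpow, ?_⟩
  have htrunc : ∀ n, 0 ≤ truncHomog x k n := fun n =>
    tsum_nonneg fun a => Finset.prod_nonneg fun p _ => pow_nonneg (hx p) _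
  have hnorm : ∀ n, ‖truncHomog x k n * (-u) ^ n‖ = truncHomog x k n * u ^ n := fun n => by
    rw [norm_mul, norm_pow, norm_neg, Real.norm_of_nonneg (htrunc n), Real.norm_of_nonneg hu]
  have hy : ∀ p, 0 ≤ u * x p := fun p => mul_nonneg hu (hx p)
  have hq : ∀ p, ∑ j ∈ Finset.range (k + 1), (-u * x p) ^ j =
      (1 + (u * x p) ^ (k + 1)) / (1 + u * x p) := fun p => by
    rw [neg_mul, geom_sum_neg_of_even hk (hy p)]
  have hQ := hasSum_truncHomog hxa k (-u)
  have hm : Multipliable fun p => (1 + (u * x p) ^ (k + 1)) / (1 + u * x p) := by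
    refine (multipliable_geom_sum (z := fun p => -u * x p) ?_ k).congr hq
    simpa only [abs_mul] using hxa.mul_left |(-u)|
  simp only [hq] at hQ
  have hdiff := abs_tprod_sub_tprod_le hy (fun p => pow_nonneg (hy p) (k + 1))
    (hsum.mul_left u) (by simpa only [mul_pow] using hpow.mul_left (u ^ (k + 1))) hm
  set Q := ∏' p, (1 + (u * x p) ^ (k + 1)) / (1 + u * x p)
  have hQle : Q ≤ ∑' n, truncHomog x k n * u ^ n := by
    rw [← hQ.tsum_eq]
    exact hQ.summable.tsum_le_tsum
      (fun n => (le_abs_self _).trans_eq (hnorm n)) hH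
  have hsplit : Q - ∑ n ∈ Finset.range (k + 1), (-u) ^ n * completeHomog x n =
      ∑' n, truncHomog x k (n + (k + 1)) * (-u) ^ (n + (k + 1)) := by
    rw [← hQ.tsum_eq, ← hQ.summable.sum_add_tsum_nat_add (k + 1), sub_eq_iff_eq_add, add_comm]
    congr 1
    refine Finset.sum_congr rfl fun n hn => ?_
    rw [truncHomog_eq_completeHomog x (Nat.le_of_lt_succ (Finset.mem_range.1 hn)), mul_comm]
  have htail : |Q - ∑ n ∈ Finset.range (k + 1), (-u) ^ n * completeHomog x n| ≤
      ∑' n, truncHomog x k (n + (k + 1)) * u ^ (n + (k + 1)) := by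
    rw [hsplit, ← Real.norm_eq_abs]
    refine (norm_tsum_le_tsum_norm ?_).trans_eq (tsum_congr fun n => hnorm _)
    simpa only [hnorm] using (summable_nat_add_iff (k + 1)).2 hH
  have hcorr : Q * ∑' p, (u * x p) ^ (k + 1) ≤
      u ^ (k + 1) * (∑' n, truncHomog x k n * u ^ n) * ∑' p, x p ^ (k + 1) := by
    simp only [mul_pow, tsum_mul_left]
    rw [← mul_assoc, mul_comm Q]
    have : 0 ≤ ∑' p, x p ^ (k + 1) := tsum_nonneg fun p => pow_nonneg (hx p) _
    gcongr
  refine (abs_sub_le _ Q _).trans ?_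
  linarith
end

section
/- Fix a natural number k ≥ 1, reals T > 0 and X, and reals α_1, …, α_k with α_A − α_B > 1 for all 1 ≤ A < B ≤ k. For t ∈ ℝ^k, set z_j = α_j + i·t_j. Then ∫_{ℝ^k} ∏_{1 ≤ A < B ≤ k} (z_A − z_B)/(z_A − z_B − 1) · exp( (T/2)·Σ_j z_j² + X·Σ_j z_j ) dt = exp( −k·X²/(2T) ) · ∫_{ℝ^k} ∏_{1 ≤ A < B ≤ k} (z_A − z_B)/(z_A − z_B − 1) · exp( (T/2)·Σ_j z_j² ) dt. -/
open MeasureTheory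

/-- The integrand of the nested contour integral in the moment formula for the SHE, the
`j`-th contour being the vertical line `α j + iℝ` parametrized by `t j`. -/
noncomputable def momentIntegrand (k : ℕ) (T X : ℝ) (α : Fin k → ℝ) (t : Fin k → ℝ) : ℂ :=
  (∏ p ∈ Finset.univ.filter (fun p : Fin k × Fin k => p.1 < p.2),
      ((((α p.1 : ℂ) + (t p.1 : ℂ) * Complex.I) - ((α p.2 : ℂ) + (t p.2 : ℂ) * Complex.I)) /
        ((((α p.1 : ℂ) + (t p.1 : ℂ) * Complex.I) -
          ((α p.2 : ℂ) + (t p.2 : ℂ) * Complex.I)) - 1))) *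
    Complex.exp (((T : ℂ) / 2) * ∑ j : Fin k, ((α j : ℂ) + (t j : ℂ) * Complex.I) ^ 2 +
      (X : ℂ) * ∑ j : Fin k, ((α j : ℂ) + (t j : ℂ) * Complex.I))

/-- The rational factor of the moment integrand. -/
noncomputable def momentKernel (k : ℕ) (α : Fin k → ℝ) (t : Fin k → ℝ) : ℂ :=
  ∏ p ∈ Finset.univ.filter (fun p : Fin k × Fin k => p.1 < p.2),
      ((((α p.1 : ℂ) + (t p.1 : ℂ) * Complex.I) - ((α p.2 : ℂ) + (t p.2 : ℂ) * Complex.I)) /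
        ((((α p.1 : ℂ) + (t p.1 : ℂ) * Complex.I) -
          ((α p.2 : ℂ) + (t p.2 : ℂ) * Complex.I)) - 1))

/-- The moment integrand at `X = 0` with all the variables translated by the same complex `w`. -/
noncomputable def shiftedMomentIntegrand (k : ℕ) (T : ℝ) (α : Fin k → ℝ) (w : ℂ)
    (t : Fin k → ℝ) : ℂ :=
  momentKernel k α t *
    Complex.exp (((T : ℂ) / 2) * ∑ j : Fin k, ((α j : ℂ) + (t j : ℂ) * Complex.I + w) ^ 2)

theorem measurable_momentKernel (k : ℕ) (α : Fin k → ℝ) : Measurable (momentKernel k α) := by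
  unfold momentKernel
  fun_prop

theorem measurable_shiftedMomentIntegrand (k : ℕ) (T : ℝ) (α : Fin k → ℝ) (w : ℂ) :
    Measurable (shiftedMomentIntegrand k T α w) := by
  have := measurable_momentKernel k α
  unfold shiftedMomentIntegrand
  fun_prop

theorem norm_div_sub_one_le {z : ℂ} {δ : ℝ} (hδ : 1 < δ) (hz : z.re = δ) :
    ‖z / (z - 1)‖ ≤ 1 + (δ - 1)⁻¹ := by
  have hre : δ - 1 ≤ ‖z - 1‖ := by
    simpa [hz] using Complex.re_le_norm (z - 1)
  have hpos : 0 < ‖z - 1‖ := by linarith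
  have hne : z - 1 ≠ 0 := norm_pos_iff.mp hpos
  have h : z / (z - 1) = 1 + (z - 1)⁻¹ := by
    field_simp
    ring
  rw [h]
  refine (norm_add_le _ _).trans ?_
  rw [norm_one, norm_inv]
  gcongr

theorem exists_norm_momentKernel_le {k : ℕ} {α : Fin k → ℝ}
    (hα : ∀ A B : Fin k, A < B → 1 < α A - α B) :
    ∃ C : ℝ, 0 ≤ C ∧ ∀ t, ‖momentKernel k α t‖ ≤ C := by
  refine ⟨∏ p ∈ Finset.univ.filter (fun p : Fin k × Fin k => p.1 < p.2),
    (1 + (α p.1 - α p.2 - 1)⁻¹), Finset.prod_nonneg fun p hp => ?_, fun t => ?_⟩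
  · have := hα p.1 p.2 (Finset.mem_filter.mp hp).2
    have : 0 < (α p.1 - α p.2 - 1)⁻¹ := inv_pos.mpr (by linarith)
    linarith
  · rw [momentKernel, norm_prod]
    refine Finset.prod_le_prod (fun _ _ => norm_nonneg _) fun p hp => ?_
    exact norm_div_sub_one_le (hα p.1 p.2 (Finset.mem_filter.mp hp).2) (by simp)

theorem integrable_exp_sum_sub_mul_sq (k : ℕ) {b : ℝ} (hb : 0 < b) (c : Fin k → ℝ) :
    Integrable (fun t : Fin k → ℝ => Real.exp (∑ j, (c j - b * t j ^ 2))) := by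
  simp_rw [Real.exp_sum]
  refine Integrable.fintype_prod (f := fun j x => Real.exp (c j - b * x ^ 2)) fun j => ?_
  simp_rw [sub_eq_add_neg, Real.exp_add, ← neg_mul]
  exact (integrable_exp_neg_mul_sq hb).const_mul _

theorem re_add_mul_I_add_sq_add_norm_le {T R a x : ℝ} (hT : 0 < T) {w : ℂ} (hw : ‖w‖ ≤ R) :
    T / 2 * (((a : ℂ) + (x : ℂ) * Complex.I + w) ^ 2).re +
        T * ‖(a : ℂ) + (x : ℂ) * Complex.I + w‖ ≤
      T * ((|a| + R) ^ 2 / 2 + |a| + R + (R + 1) ^ 2) - T / 4 * x ^ 2 := by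
  have hnorm : ‖(a : ℂ) + (x : ℂ) * Complex.I + w‖ ≤ |a| + |x| + R := by
    refine (norm_add_le _ _).trans (add_le_add ((norm_add_le _ _).trans ?_) hw)
    simp
  have hre : (((a : ℂ) + (x : ℂ) * Complex.I + w) ^ 2).re = (a + w.re) ^ 2 - (x + w.im) ^ 2 := by
    simp [pow_two]
  have h1 : (a + w.re) ^ 2 ≤ (|a| + R) ^ 2 := by
    rw [← sq_abs]
    gcongr
    exact (abs_add_le _ _).trans (by gcongr; exact (Complex.abs_re_le_norm w).trans hw)
  have h2 : -(x * w.im) ≤ |x| * R := by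
    refine (neg_le_abs _).trans ?_
    rw [abs_mul]
    gcongr
    exact (Complex.abs_im_le_norm w).trans hw
  have h3 := sq_nonneg (|x| / 2 - (R + 1))
  have h4 : |x| ^ 2 = x ^ 2 := sq_abs x
  rw [hre]
  have key : ((a + w.re) ^ 2 - (x + w.im) ^ 2) / 2 + ‖(a : ℂ) + (x : ℂ) * Complex.I + w‖ ≤
      (|a| + R) ^ 2 / 2 + |a| + R + (R + 1) ^ 2 - x ^ 2 / 4 := by
    nlinarith [sq_nonneg w.im]
  nlinarith [mul_le_mul_of_nonneg_left key hT.le]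

theorem norm_cexp_mul_exp_sum_norm_le {k : ℕ} {T R : ℝ} (hT : 0 < T) (α t : Fin k → ℝ) {w : ℂ}
    (hw : ‖w‖ ≤ R) :
    ‖Complex.exp (((T : ℂ) / 2) *
        ∑ j : Fin k, ((α j : ℂ) + (t j : ℂ) * Complex.I + w) ^ 2)‖ *
        Real.exp (T * ∑ j : Fin k, ‖(α j : ℂ) + (t j : ℂ) * Complex.I + w‖) ≤
      Real.exp (∑ j, (T * ((|α j| + R) ^ 2 / 2 + |α j| + R + (R + 1) ^ 2) - T / 4 * t j ^ 2)) := by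
  rw [Complex.norm_exp, ← Real.exp_add, Real.exp_le_exp]
  have h : (((T : ℂ) / 2) * ∑ j : Fin k, ((α j : ℂ) + (t j : ℂ) * Complex.I + w) ^ 2).re =
      T / 2 * ∑ j : Fin k, (((α j : ℂ) + (t j : ℂ) * Complex.I + w) ^ 2).re := by
    rw [← Complex.re_sum, ← Complex.re_ofReal_mul]
    push_cast
    rfl
  rw [h, Finset.mul_sum, Finset.mul_sum, ← Finset.sum_add_distrib]
  exact Finset.sum_le_sum fun j _ => re_add_mul_I_add_sq_add_norm_le hT hw

theorem hasDerivAt_shiftedMomentIntegrand (k : ℕ) (T : ℝ) (α t : Fin k → ℝ) (w : ℂ) :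
    HasDerivAt (fun w => shiftedMomentIntegrand k T α w t)
      (shiftedMomentIntegrand k T α w t *
        (T * ∑ j : Fin k, ((α j : ℂ) + (t j : ℂ) * Complex.I + w))) w := by
  have hsum : HasDerivAt
      (fun w : ℂ => ∑ j : Fin k, ((α j : ℂ) + (t j : ℂ) * Complex.I + w) ^ 2)
      (∑ j : Fin k, 2 * ((α j : ℂ) + (t j : ℂ) * Complex.I + w)) w := by
    refine HasDerivAt.fun_sum fun j _ => ?_
    simpa using ((hasDerivAt_id w).const_add ((α j : ℂ) + (t j : ℂ) * Complex.I)).fun_pow 2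
  refine (((hsum.const_mul ((T : ℂ) / 2)).cexp).const_mul (momentKernel k α t)).congr_deriv ?_
  rw [shiftedMomentIntegrand, ← Finset.mul_sum]
  ring

theorem differentiable_integral_shiftedMomentIntegrand {k : ℕ} {T : ℝ} (hT : 0 < T)
    {α : Fin k → ℝ} (hα : ∀ A B : Fin k, A < B → 1 < α A - α B) :
    Differentiable ℂ (fun w => ∫ t : Fin k → ℝ, shiftedMomentIntegrand k T α w t) := by
  intro w₀
  obtain ⟨C, hC, hCb⟩ := exists_norm_momentKernel_le hα
  set R := ‖w₀‖ + 1
  let g : (Fin k → ℝ) → ℝ := fun t => C * Real.exp (∑ j,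
    (T * ((|α j| + R) ^ 2 / 2 + |α j| + R + (R + 1) ^ 2) - T / 4 * t j ^ 2))
  have hg : Integrable g := (integrable_exp_sum_sub_mul_sq k (by positivity) _).const_mul C
  have hbound : ∀ w : ℂ, ‖w‖ ≤ R → ∀ t (y : ℝ), 0 ≤ y →
      y ≤ Real.exp (T * ∑ j : Fin k, ‖(α j : ℂ) + (t j : ℂ) * Complex.I + w‖) →
      ‖shiftedMomentIntegrand k T α w t‖ * y ≤ g t := by
    intro w hw t y hy0 hy
    rw [shiftedMomentIntegrand, norm_mul, mul_assoc]
    refine mul_le_mul (hCb t) ?_ (by positivity) hC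
    exact (mul_le_mul_of_nonneg_left hy (norm_nonneg _)).trans
      (norm_cexp_mul_exp_sum_norm_le hT α t hw)
  refine (hasDerivAt_integral_of_dominated_loc_of_deriv_le (bound := g)
    (F' := fun w t => shiftedMomentIntegrand k T α w t *
        (T * ∑ j : Fin k, ((α j : ℂ) + (t j : ℂ) * Complex.I + w)))
    (Metric.ball_mem_nhds w₀ one_pos) ?_ ?_ ?_ ?_ hg ?_).2.differentiableAt
  · exact .of_forall fun w => (measurable_shiftedMomentIntegrand k T α w).aestronglyMeasurable
  · refine hg.mono' (measurable_shiftedMomentIntegrand k T α w₀).aestronglyMeasurable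
      (.of_forall fun t => ?_)
    simpa using hbound w₀ (by simp [R]) t 1 zero_le_one (Real.one_le_exp (by positivity))
  · have := measurable_shiftedMomentIntegrand k T α w₀
    exact Measurable.aestronglyMeasurable (by fun_prop)
  · refine .of_forall fun t w hw => ?_
    rw [norm_mul]
    refine hbound w ?_ t _ (norm_nonneg _) ?_
    · have h1 := norm_le_norm_add_norm_sub' w w₀
      have h2 := mem_ball_iff_norm.mp hw
      simp only [R]
      linarith
    · rw [norm_mul, Complex.norm_real, Real.norm_of_nonneg hT.le]
      refine le_trans ?_ ((le_add_of_nonneg_right zero_le_one).trans (Real.add_one_le_exp _))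
      gcongr
      exact norm_sum_le _ _
  · exact .of_forall fun t w _ => hasDerivAt_shiftedMomentIntegrand k T α t w

theorem integral_shiftedMomentIntegrand_add_mul_I (k : ℕ) (T : ℝ) (α : Fin k → ℝ) (w : ℂ)
    (c : ℝ) :
    (∫ t : Fin k → ℝ, shiftedMomentIntegrand k T α (w + c * Complex.I) t) =
      ∫ t : Fin k → ℝ, shiftedMomentIntegrand k T α w t := by
  rw [← integral_add_right_eq_self (shiftedMomentIntegrand k T α w) (fun _ => c)]
  congr 1 with t
  simp only [shiftedMomentIntegrand, momentKernel, Pi.add_apply, Complex.ofReal_add]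
  congr 1
  · refine Finset.prod_congr rfl fun p _ => ?_
    congr 1 <;> ring
  · congr 2
    refine Finset.sum_congr rfl fun j _ => ?_
    ring

/-- An entire function invariant under purely imaginary translations is constant. -/
theorem eq_of_differentiable_of_add_mul_I {G : ℂ → ℂ} (hG : Differentiable ℂ G)
    (h : ∀ (w : ℂ) (c : ℝ), G (w + c * Complex.I) = G w) (w w' : ℂ) : G w = G w' := by
  refine is_const_of_deriv_eq_zero hG (fun w => ?_) w w'
  have hline : HasDerivAt (fun c : ℝ => w + (c : ℂ) * Complex.I) Complex.I 0 := by
    simpa using ((Complex.ofRealCLM.hasDerivAt (x := (0 : ℝ))).mul_const Complex.I).const_add w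
  have hcomp : HasDerivAt (fun c : ℝ => G (w + (c : ℂ) * Complex.I))
      (deriv G w * Complex.I) 0 := by
    refine HasDerivAt.comp (0 : ℝ) (h₂ := G) ?_ hline
    simpa using (hG w).hasDerivAt
  simp_rw [h] at hcomp
  simpa using hcomp.unique (hasDerivAt_const (0 : ℝ) (G w))

theorem momentIntegrand_zero (k : ℕ) (T : ℝ) (α t : Fin k → ℝ) :
    momentIntegrand k T 0 α t = shiftedMomentIntegrand k T α 0 t := by
  simp [momentIntegrand, shiftedMomentIntegrand, momentKernel]

theorem momentIntegrand_eq_exp_mul_shiftedMomentIntegrand (k : ℕ) {T : ℝ} (hT : T ≠ 0) (X : ℝ)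
    (α t : Fin k → ℝ) :
    momentIntegrand k T X α t = (Real.exp (-(k : ℝ) * X ^ 2 / (2 * T)) : ℂ) *
      shiftedMomentIntegrand k T α ((X : ℂ) / T) t := by
  have hT' : (T : ℂ) ≠ 0 := by exact_mod_cast hT
  rw [momentIntegrand, shiftedMomentIntegrand, momentKernel, mul_left_comm, Complex.ofReal_exp,
    ← Complex.exp_add]
  congr 2
  generalize hz : (fun j : Fin k => (α j : ℂ) + (t j : ℂ) * Complex.I) = z
  simp_rw [funext_iff] at hz
  simp_rw [hz, add_sq _ ((X : ℂ) / T), Finset.sum_add_distrib, ← Finset.sum_mul, ← Finset.mul_sum,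
    Finset.sum_const, Finset.card_univ, Fintype.card_fin, nsmul_eq_mul]
  push_cast
  field_simp
  ring

theorem moment_integral_spatial_factorization
    (k : ℕ) (hk : 1 ≤ k) (T X : ℝ) (hT : 0 < T) (α : Fin k → ℝ)
    (hα : ∀ A B : Fin k, A < B → 1 < α A - α B) :
    (∫ t : Fin k → ℝ, momentIntegrand k T X α t) =
      (Real.exp (-(k : ℝ) * X ^ 2 / (2 * T)) : ℂ) *
        ∫ t : Fin k → ℝ, momentIntegrand k T 0 α t := by
  simp_rw [momentIntegrand_eq_exp_mul_shiftedMomentIntegrand k hT.ne' X, momentIntegrand_zero]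
  rw [integral_const_mul]
  congr 1
  exact eq_of_differentiable_of_add_mul_I
    (differentiable_integral_shiftedMomentIntegrand hT hα)
    (integral_shiftedMomentIntegrand_add_mul_I k T α) _ _
end
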